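/- Let h, σ : ℝ → ℝ be continuous functions with σ(t) > 0 for all t. For real s ≤ t define a(s,t) = exp(∫_s^t h(τ) dτ) and b(s,t) = ∫_s^t σ(v)^2 · a(v,t)^2 dv, and for t ∈ [0,1] define κ(t) = b(0,t)·a(t,1)/b(0,1) and ν(t) = b(t,1)·a(0,t)/b(0,1). Then for every t ∈ (0,1), the derivatives satisfy κ'(t) = (κ(t)/ν(t))·ν'(t) + σ(t)^2 · a(t,1)/b(t,1). -/

import Mathlib

/-- `a s t = exp (∫_s^t h τ dτ)`, the transition factor of the linear SDE. -/
noncomputable def aCoef (h : ℝ → ℝ) (s t : ℝ) : ℝ := Real.exp (∫ τ in s..t, h τ)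

/-- `b s t = ∫_s^t σ(v)^2 a(v,t)^2 dv`, the accumulated variance. -/
noncomputable def bCoef (h σ : ℝ → ℝ) (s t : ℝ) : ℝ :=
  ∫ v in s..t, σ v ^ 2 * aCoef h v t ^ 2

/-- `κ t = b(0,t) a(t,1) / b(0,1)`, the `z₁`-coefficient of the interpolant. -/
noncomputable def kappaC (h σ : ℝ → ℝ) (t : ℝ) : ℝ :=
  bCoef h σ 0 t * aCoef h t 1 / bCoef h σ 0 1

/-- `ν t = b(t,1) a(0,t) / b(0,1)`, the `z₀`-coefficient of the interpolant. -/
noncomputable def nuC (h σ : ℝ → ℝ) (t : ℝ) : ℝ :=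
  bCoef h σ t 1 * aCoef h 0 t / bCoef h σ 0 1

/-- `η t = √(b(0,t) b(t,1) / b(0,1))`, the noise coefficient of the interpolant. -/
noncomputable def etaC (h σ : ℝ → ℝ) (t : ℝ) : ℝ :=
  Real.sqrt (bCoef h σ 0 t * bCoef h σ t 1 / bCoef h σ 0 1)

theorem aCoef_eq (h : ℝ → ℝ) (hh : Continuous h) (s t : ℝ) :
    aCoef h s t = aCoef h 0 t / aCoef h 0 s := by
  unfold aCoef
  rw [← Real.exp_sub, intervalIntegral.integral_interval_sub_left
    (hh.intervalIntegrable _ _) (hh.intervalIntegrable _ _)]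

theorem aCoef_hasDerivAt (h : ℝ → ℝ) (hh : Continuous h) (t : ℝ) :
    HasDerivAt (fun x => aCoef h 0 x) (aCoef h 0 t * h t) t := by
  unfold aCoef
  exact (hh.integral_hasStrictDerivAt 0 t).hasDerivAt.exp

theorem aCoef_pos (h : ℝ → ℝ) (s t : ℝ) : 0 < aCoef h s t := Real.exp_pos _

theorem gCont (h σ : ℝ → ℝ) (hh : Continuous h) (hσ : Continuous σ) :
    Continuous (fun v => σ v ^ 2 / aCoef h 0 v ^ 2) := by
  have hc : Continuous (fun x => aCoef h 0 x) :=
    continuous_iff_continuousAt.2 fun x => (aCoef_hasDerivAt h hh x).continuousAt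
  exact (hσ.pow 2).div (hc.pow 2) fun x => (pow_pos (aCoef_pos h 0 x) 2).ne'

theorem bCoef_eq (h σ : ℝ → ℝ) (hh : Continuous h) (hσ : Continuous σ) (s t : ℝ) :
    bCoef h σ s t = aCoef h 0 t ^ 2 * ((∫ v in (0:ℝ)..t, σ v ^ 2 / aCoef h 0 v ^ 2) -
      ∫ v in (0:ℝ)..s, σ v ^ 2 / aCoef h 0 v ^ 2) := by
  have hg := gCont h σ hh hσ
  rw [intervalIntegral.integral_interval_sub_left
    (hg.intervalIntegrable _ _) (hg.intervalIntegrable _ _),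
    ← intervalIntegral.integral_const_mul]
  unfold bCoef
  congr 1
  ext v
  rw [aCoef_eq h hh v t]
  ring

/-- `κ'(t) = (κ(t)/ν(t)) ν'(t) + σ(t)^2 a(t,1)/b(t,1)` on `(0,1)`. -/
theorem kappa_deriv_eq (h σ : ℝ → ℝ) (hh : Continuous h) (hσ : Continuous σ)
    (hσpos : ∀ t, 0 < σ t) (t : ℝ) (ht : t ∈ Set.Ioo (0 : ℝ) 1) :
    deriv (kappaC h σ) t =
      (kappaC h σ t / nuC h σ t) * deriv (nuC h σ) t +
        σ t ^ 2 * aCoef h t 1 / bCoef h σ t 1 := by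
  have hg := gCont h σ hh hσ
  have hgpos : ∀ v, 0 < σ v ^ 2 / aCoef h 0 v ^ 2 := fun v =>
    div_pos (pow_pos (hσpos v) 2) (pow_pos (aCoef_pos h 0 v) 2)
  have hb := bCoef_eq h σ hh hσ
  obtain ⟨G, hG⟩ : ∃ G : ℝ → ℝ, G = fun x => ∫ v in (0:ℝ)..x, σ v ^ 2 / aCoef h 0 v ^ 2 :=
    ⟨_, rfl⟩
  have hb' : ∀ s t, bCoef h σ s t = aCoef h 0 t ^ 2 * (G t - G s) := by
    intro s t; rw [hb, hG]
  have hGd : HasDerivAt G (σ t ^ 2 / aCoef h 0 t ^ 2) t := by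
    rw [hG]; exact (hg.integral_hasStrictDerivAt 0 t).hasDerivAt
  have hG0 : G 0 = 0 := by rw [hG]; simp
  have hmono : ∀ x y, x < y → 0 < G y - G x := by
    intro x y hxy
    simp only [hG]
    rw [intervalIntegral.integral_interval_sub_left
      (hg.intervalIntegrable _ _) (hg.intervalIntegrable _ _)]
    exact intervalIntegral.intervalIntegral_pos_of_pos (hg.intervalIntegrable _ _) hgpos hxy
  have h1 : 0 < G 1 := by have := hmono 0 1 one_pos; rwa [hG0, sub_zero] at this
  have h2 : 0 < G 1 - G t := hmono t 1 ht.2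
  have hE := aCoef_hasDerivAt h hh t
  have hEp : ∀ x, aCoef h 0 x ≠ 0 := fun x => (aCoef_pos h 0 x).ne'
  have e1 := hEp 1
  have et := hEp t
  have n1 := h1.ne'
  have n2 := h2.ne'
  have hκ : kappaC h σ = fun x => aCoef h 0 x * G x / (aCoef h 0 1 * G 1) := by
    ext x
    have := hEp x
    unfold kappaC
    rw [hb', hb', hG0, aCoef_eq h hh x 1, sub_zero, sub_zero]
    field_simp
  have hν : nuC h σ = fun x => aCoef h 0 x * (G 1 - G x) / G 1 := by
    ext x
    unfold nuC
    rw [hb', hb', hG0, sub_zero]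
    field_simp
  have dκ := (hE.mul hGd).div_const (aCoef h 0 1 * G 1)
  have dν := (hE.mul (hGd.const_sub (G 1))).div_const (G 1)
  have dκ' := (show HasDerivAt (kappaC h σ) _ t by rw [hκ]; exact dκ).deriv
  have dν' := (show HasDerivAt (nuC h σ) _ t by rw [hν]; exact dν).deriv
  rw [dκ', dν', hκ, hν, hb', aCoef_eq h hh t 1]
  field_simp
  ring
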